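/- Local central limit theorem for the long-range random walk, case α = 2 (Lemma LCLT): for every integer d ≥ 1 and every t > 0, lim_{N→+∞} sup_{x ∈ Z^d} | (N log N)^{d/2} · p_{tN}^{d,2}(0,x) − f_t^{d,2}(x/√(N log N)) | = 0, where the limit is taken as the real parameter N tends to +∞ over N > 1. -/

import Mathlib

open MeasureTheory Filter Real Topology

/-- Euclidean (l²) norm of a vector in `Fin d → ℝ`. -/
noncomputable def l2norm {d : ℕ} (u : Fin d → ℝ) : ℝ := Real.sqrt (∑ i, u i ^ 2)

/-- Euclidean norm of a lattice point. -/
noncomputable def zl2 {d : ℕ} (y : Fin d → ℤ) : ℝ := l2norm (fun i => (y i : ℝ))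

/-- The symbol `Σ_{y ≠ 0} (cos(θ·y) − 1)/‖y‖₂^{d+α}` of the long-range random walk. -/
noncomputable def latticeSymbol (d : ℕ) (α : ℝ) (θ : Fin d → ℝ) : ℝ :=
  ∑' y : {y : Fin d → ℤ // y ≠ 0},
    (Real.cos (∑ i, θ i * (y.1 i : ℝ)) - 1) / zl2 y.1 ^ ((d : ℝ) + α)

/-- Transition probability `p_t^{d,α}(0,x)` of the long-range random walk, defined through
the Fourier inversion formula. -/
noncomputable def pTrans (d : ℕ) (α : ℝ) (t : ℝ) (x : Fin d → ℤ) : ℝ :=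
  ((2 * Real.pi) ^ d)⁻¹ *
    ∫ θ in Set.univ.pi (fun _ : Fin d => Set.Icc (-Real.pi) Real.pi),
      Real.exp (t * latticeSymbol d α θ) * Real.cos (∑ i, (x i : ℝ) * θ i)

/-- The constant `G̃^{d,α} = ∫_{R^d} (1 − cos v₁)/‖v‖₂^{d+α} dv`. -/
noncomputable def Gtilde (d : ℕ) (α : ℝ) : ℝ :=
  ∫ v : Fin d → ℝ, (1 - Real.cos (if h : 0 < d then v ⟨0, h⟩ else 0)) / l2norm v ^ ((d : ℝ) + α)

/-- The density `f_t^{d,α}` of the limiting stable law (case `0 < α < 2`). -/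
noncomputable def fDensity (d : ℕ) (α : ℝ) (t : ℝ) (u : Fin d → ℝ) : ℝ :=
  ((2 * Real.pi) ^ d)⁻¹ *
    ∫ θ : Fin d → ℝ, Real.cos (∑ i, θ i * u i) * Real.exp (-(t * l2norm θ ^ α * Gtilde d α))

/-- The constant `K^{i,j} = (1/2) ∫_{S^{d−1}} v_i v_j dσ(v)`, where `σ` is the surface
measure on the unit sphere of `R^d`. -/
noncomputable def Kconst (d : ℕ) (i j : Fin d) : ℝ :=
  (1 / 2 : ℝ) * ∫ v : Metric.sphere (0 : EuclideanSpace ℝ (Fin d)) 1,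
    ((v : EuclideanSpace ℝ (Fin d)) i * (v : EuclideanSpace ℝ (Fin d)) j)
      ∂((volume : Measure (EuclideanSpace ℝ (Fin d))).toSphere)

/-- The Gaussian density `f_t^{d,2}` of the limiting law in the critical case `α = 2`. -/
noncomputable def fDensityTwo (d : ℕ) (t : ℝ) (u : Fin d → ℝ) : ℝ :=
  ((2 * Real.pi) ^ d)⁻¹ *
    ∫ θ : Fin d → ℝ, Real.cos (∑ i, θ i * u i) *
      Real.exp (-(t / 2) * ∑ i, ∑ j, Kconst d i j * θ i * θ j)


lemma l2norm_eq_norm {d : ℕ} (v : EuclideanSpace ℝ (Fin d)) : l2norm (fun i => v i) = ‖v‖ := by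
  simp [l2norm, EuclideanSpace.norm_eq]

/-- Volume of the unit Euclidean ball, as a subset of `Fin d → ℝ`. -/
noncomputable def unitBallVol (d : ℕ) : ℝ := volume.real {x : Fin d → ℝ | l2norm x ≤ 1}

lemma unitBallVol_eq (d : ℕ) [NeZero d] :
    unitBallVol d = volume.real (Metric.ball (0 : EuclideanSpace ℝ (Fin d)) 1) := by
  have h : {x : Fin d → ℝ | l2norm x ≤ 1} =
      (MeasurableEquiv.toLp 2 (Fin d → ℝ)) ⁻¹'
        Metric.closedBall (0 : EuclideanSpace ℝ (Fin d)) 1 := by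
    ext x
    simp [← l2norm_eq_norm]
  have hv : MeasurePreserving (MeasurableEquiv.toLp 2 (Fin d → ℝ)) volume volume :=
    PiLp.volume_preserving_toLp (Fin d)
  rw [unitBallVol, h, measureReal_def, measureReal_def, hv.measure_preimage_equiv]
  congr 1
  have : Nonempty (Fin d) := ⟨0⟩
  rw [Measure.addHaar_closedBall_eq_addHaar_ball]

lemma unitBallVol_pos (d : ℕ) [NeZero d] : 0 < unitBallVol d := by
  rw [unitBallVol_eq, measureReal_def]
  exact ENNReal.toReal_pos (Metric.measure_ball_pos _ _ one_pos).ne' measure_ball_lt_top.ne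

section Sphere

variable {E : Type*} [NormedAddCommGroup E] [InnerProductSpace ℝ E] [FiniteDimensional ℝ E]
  [MeasurableSpace E] [BorelSpace E]

/-- The action of a linear isometry on the unit sphere. -/
def sphereMap (e : E ≃ₗᵢ[ℝ] E) : Metric.sphere (0 : E) 1 ≃ᵐ Metric.sphere (0 : E) 1 where
  toFun v := ⟨e v, by simp⟩
  invFun v := ⟨e.symm v, by simp⟩
  left_inv v := by simp
  right_inv v := by simp
  measurable_toFun := by
    apply Measurable.subtype_mk
    exact e.continuous.measurable.comp measurable_subtype_coe
  measurable_invFun := by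
    apply Measurable.subtype_mk
    exact e.symm.continuous.measurable.comp measurable_subtype_coe

lemma measurePreserving_sphereMap (e : E ≃ₗᵢ[ℝ] E) :
    MeasurePreserving (sphereMap e) (volume : Measure E).toSphere (volume : Measure E).toSphere := by
  refine ⟨(sphereMap e).measurable, ?_⟩
  ext s hs
  rw [Measure.map_apply (sphereMap e).measurable hs, Measure.toSphere_apply' _ hs,
    Measure.toSphere_apply' _ ((sphereMap e).measurable hs)]
  congr 1
  have hv : MeasurePreserving e.toMeasurableEquiv volume volume := e.measurePreserving
  symm
  rw [← hv.measure_preimage_equiv]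
  congr 1
  ext x
  simp only [Set.mem_smul, Set.mem_image, Set.mem_preimage]
  constructor
  · rintro ⟨r, hr, _, ⟨v, hv, rfl⟩, hx⟩
    refine ⟨r, hr, _, ⟨(sphereMap e).symm v, by simpa using hv, rfl⟩, ?_⟩
    have : e (r • e.symm v) = e x := by simpa using hx
    exact e.injective this
  · rintro ⟨r, hr, _, ⟨v, hv, rfl⟩, rfl⟩
    exact ⟨r, hr, _, ⟨_, hv, rfl⟩, by simp [sphereMap]⟩

end Sphere

lemma Kconst_comp {d : ℕ} (i j : Fin d)
    (e : EuclideanSpace ℝ (Fin d) ≃ₗᵢ[ℝ] EuclideanSpace ℝ (Fin d)) :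
    Kconst d i j = (1 / 2 : ℝ) * ∫ v : Metric.sphere (0 : EuclideanSpace ℝ (Fin d)) 1,
      (e v i * e v j) ∂((volume : Measure (EuclideanSpace ℝ (Fin d))).toSphere) := by
  rw [Kconst, ← (measurePreserving_sphereMap e).integral_comp' (g := fun v =>
    ((v : EuclideanSpace ℝ (Fin d)) i * (v : EuclideanSpace ℝ (Fin d)) j))]
  rfl

lemma Kconst_of_ne {d : ℕ} {i j : Fin d} (h : i ≠ j) : Kconst d i j = 0 := by
  let e : EuclideanSpace ℝ (Fin d) ≃ₗᵢ[ℝ] EuclideanSpace ℝ (Fin d) :=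
    LinearIsometryEquiv.piLpCongrRight 2
      (fun k => if k = i then LinearIsometryEquiv.neg ℝ else LinearIsometryEquiv.refl ℝ ℝ)
  have h1 := Kconst_comp i j e
  have h2 : ∀ v : EuclideanSpace ℝ (Fin d), e v i * e v j = -(v i * v j) := by
    intro v
    simp [e, h.symm]
  simp only [h2, integral_neg] at h1
  have : Kconst d i j = - Kconst d i j := by
    conv_lhs => rw [h1]
    rw [Kconst]; ring
  linarith

lemma Kconst_self_eq {d : ℕ} (i j : Fin d) : Kconst d i i = Kconst d j j := by
  rw [Kconst_comp i i (LinearIsometryEquiv.piLpCongrLeft 2 ℝ ℝ (Equiv.swap i j)), Kconst]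
  congr 2
  ext v
  simp [LinearIsometryEquiv.piLpCongrLeft_apply]

lemma Kconst_self {d : ℕ} [NeZero d] (i : Fin d) : Kconst d i i = unitBallVol d / 2 := by
  have h1 : ∑ j, Kconst d j j = d * Kconst d i i := by
    simp [fun j => Kconst_self_eq j i]
  have h2 : ∑ j, Kconst d j j = (1 / 2 : ℝ) * (d * unitBallVol d) := by
    simp only [Kconst]
    rw [← Finset.mul_sum, ← integral_finsetSum]
    · have : ∀ v : Metric.sphere (0 : EuclideanSpace ℝ (Fin d)) 1,
          ∑ j, (v : EuclideanSpace ℝ (Fin d)) j * (v : EuclideanSpace ℝ (Fin d)) j = 1 := by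
        intro v
        have := EuclideanSpace.norm_sq_eq (v : EuclideanSpace ℝ (Fin d))
        simp only [norm_eq_of_mem_sphere, Real.norm_eq_abs, sq_abs] at this
        simp only [← pow_two, ← this, one_pow]
      simp only [this, integral_const, smul_eq_mul, mul_one]
      rw [Measure.toSphere_real_apply_univ, unitBallVol_eq]
      simp
    · intro j _
      have hc : Continuous (fun v : Metric.sphere (0 : EuclideanSpace ℝ (Fin d)) 1 =>
          (v : EuclideanSpace ℝ (Fin d)) j * (v : EuclideanSpace ℝ (Fin d)) j) := by fun_prop
      exact hc.integrable_of_hasCompactSupport (HasCompactSupport.of_compactSpace _)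
  have hd : (d : ℝ) ≠ 0 := by exact_mod_cast NeZero.ne d
  rw [h1] at h2
  field_simp at h2 ⊢
  linarith

lemma sum_Kconst {d : ℕ} [NeZero d] (θ : Fin d → ℝ) :
    ∑ i, ∑ j, Kconst d i j * θ i * θ j = unitBallVol d / 2 * ∑ i, θ i ^ 2 := by
  rw [Finset.mul_sum]
  refine Finset.sum_congr rfl fun i _ => ?_
  rw [Finset.sum_eq_single i (fun j _ hj => by simp [Kconst_of_ne hj.symm]) (by simp),
    Kconst_self]
  ring

lemma l2norm_nonneg {d : ℕ} (u : Fin d → ℝ) : 0 ≤ l2norm u := Real.sqrt_nonneg _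

lemma l2norm_sq {d : ℕ} (u : Fin d → ℝ) : l2norm u ^ 2 = ∑ i, u i ^ 2 :=
  Real.sq_sqrt (Finset.sum_nonneg fun _ _ => sq_nonneg _)

lemma continuous_l2norm {d : ℕ} : Continuous (l2norm : (Fin d → ℝ) → ℝ) := by
  unfold l2norm; fun_prop

lemma abs_apply_le_l2norm {d : ℕ} (u : Fin d → ℝ) (i : Fin d) : |u i| ≤ l2norm u := by
  rw [l2norm, ← Real.sqrt_sq_eq_abs]
  exact Real.sqrt_le_sqrt
    (Finset.single_le_sum (f := fun i => u i ^ 2) (fun _ _ => sq_nonneg _) (Finset.mem_univ i))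

lemma l2norm_smul {d : ℕ} (c : ℝ) (u : Fin d → ℝ) : l2norm (c • u) = |c| * l2norm u := by
  rw [l2norm, l2norm, ← Real.sqrt_sq_eq_abs, ← Real.sqrt_mul (sq_nonneg _)]
  simp [mul_pow, Finset.mul_sum]

lemma abs_sum_mul_le {d : ℕ} (u v : Fin d → ℝ) : |∑ i, u i * v i| ≤ l2norm u * l2norm v := by
  apply abs_le_of_sq_le_sq
  · rw [mul_pow, l2norm_sq, l2norm_sq]
    exact Finset.sum_mul_sq_le_sq_mul_sq _ _ _
  · exact mul_nonneg (l2norm_nonneg _) (l2norm_nonneg _)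

lemma zl2_nonneg {d : ℕ} (y : Fin d → ℤ) : 0 ≤ zl2 y := l2norm_nonneg _

lemma zl2_zero {d : ℕ} : zl2 (0 : Fin d → ℤ) = 0 := by simp [zl2, l2norm]

lemma one_le_zl2 {d : ℕ} {y : Fin d → ℤ} (hy : y ≠ 0) : 1 ≤ zl2 y := by
  obtain ⟨i, hi⟩ := Function.ne_iff.mp hy
  refine le_trans ?_ (abs_apply_le_l2norm _ i)
  exact_mod_cast Int.one_le_abs hi

lemma zl2_pos {d : ℕ} {y : Fin d → ℤ} (hy : y ≠ 0) : 0 < zl2 y :=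
  one_pos.trans_le (one_le_zl2 hy)

/-- The nonzero lattice points of Euclidean norm at most `r`. -/
noncomputable def latBall (d : ℕ) (r : ℝ) : Finset (Fin d → ℤ) :=
  (Fintype.piFinset fun _ => Finset.Icc (-⌊r⌋) ⌊r⌋).filter (fun y => y ≠ 0 ∧ zl2 y ≤ r)

lemma mem_latBall {d : ℕ} {r : ℝ} {y : Fin d → ℤ} : y ∈ latBall d r ↔ y ≠ 0 ∧ zl2 y ≤ r := by
  simp only [latBall, Finset.mem_filter, Fintype.mem_piFinset, Finset.mem_Icc,
    and_iff_right_iff_imp]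
  rintro ⟨-, h⟩ i
  rw [← abs_le, Int.le_floor]
  exact le_trans (by simpa [zl2] using abs_apply_le_l2norm (fun i => (y i : ℝ)) i) h

lemma latBall_mono {d : ℕ} : Monotone (latBall d) := fun r s h y hy => by
  rw [mem_latBall] at hy ⊢
  exact ⟨hy.1, hy.2.trans h⟩

lemma latBall_eq_empty {d : ℕ} {r : ℝ} (hr : r < 1) : latBall d r = ∅ := by
  ext y
  simp only [mem_latBall, Finset.notMem_empty, iff_false, not_and, not_le]
  exact fun hy => hr.trans_le (one_le_zl2 hy)

lemma convex_l2ball (d : ℕ) : Convex ℝ {x : Fin d → ℝ | l2norm x ≤ 1} := by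
  have h : {x : Fin d → ℝ | l2norm x ≤ 1} =
      (WithLp.linearEquiv 2 ℝ (Fin d → ℝ)).symm ⁻¹'
        Metric.closedBall (0 : EuclideanSpace ℝ (Fin d)) 1 := by
    ext x
    simp [← l2norm_eq_norm]
  rw [h]
  exact (convex_closedBall _ _).linear_preimage _

open scoped Pointwise in
lemma tendsto_card_latBall (d : ℕ) [NeZero d] :
    Tendsto (fun r : ℝ => ((latBall d r).card : ℝ) / r ^ d) atTop (𝓝 (unitBallVol d)) := by
  have hb : Bornology.IsBounded {x : Fin d → ℝ | l2norm x ≤ 1} := by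
    refine (Metric.isBounded_closedBall (x := (0 : Fin d → ℝ)) (r := 1)).subset fun x hx => ?_
    rw [mem_closedBall_zero_iff, pi_norm_le_iff_of_nonneg zero_le_one]
    exact fun i => (abs_apply_le_l2norm x i).trans hx
  have hm : MeasurableSet {x : Fin d → ℝ | l2norm x ≤ 1} :=
    measurableSet_le continuous_l2norm.measurable measurable_const
  have hs : ∀ x y : ℝ, 0 < x → x ≤ y →
      x • {x : Fin d → ℝ | l2norm x ≤ 1} ⊆ y • {x : Fin d → ℝ | l2norm x ≤ 1} := by
    rintro x y hx hxy _ ⟨z, hz, rfl⟩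
    have hy := hx.trans_le hxy
    refine ⟨(x / y) • z, ?_, ?_⟩
    · simp only [Set.mem_ofPred_eq] at hz ⊢
      rw [l2norm_smul, abs_of_pos (by positivity)]
      exact mul_le_one₀ ((div_le_one hy).2 hxy) (l2norm_nonneg _) hz
    · simp only [smul_smul]
      congr 1
      field_simp
  have key := tendsto_card_div_pow_atTop_volume' _ hb hm ((convex_l2ball d).addHaar_frontier _) hs
  have h0 : Tendsto (fun r : ℝ => 1 / r ^ d) atTop (𝓝 0) := by
    simpa using (tendsto_pow_neg_atTop (𝕜 := ℝ) (NeZero.ne d))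
  have h1 := key.sub h0
  rw [sub_zero] at h1
  refine h1.congr' ?_
  filter_upwards [eventually_gt_atTop 0] with r hr
  rw [Fintype.card_fin, ← sub_div]
  congr 1
  rw [sub_eq_iff_eq_add]
  have hcard : (insert 0 (latBall d r)).card = (latBall d r).card + 1 :=
    Finset.card_insert_of_notMem (by simp [mem_latBall])
  have himg : {x : Fin d → ℝ | l2norm x ≤ 1} ∩
      r⁻¹ • (Submodule.span ℤ (Set.range (Pi.basisFun ℝ (Fin d))) : Set (Fin d → ℝ)) =
      (fun (y : Fin d → ℤ) => r⁻¹ • (fun i => (y i : ℝ))) ''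
        (insert 0 (latBall d r) : Finset (Fin d → ℤ)) := by
    ext x
    simp only [Set.mem_inter_iff, Set.mem_ofPred_eq, Set.mem_smul_set, Set.mem_image,
      Finset.mem_insert, mem_latBall, SetLike.mem_coe,
      Module.Basis.mem_span_iff_repr_mem, Pi.basisFun_repr]
    have hnorm : ∀ y : Fin d → ℤ, l2norm (r⁻¹ • (fun i => (y i : ℝ))) ≤ 1 ↔ zl2 y ≤ r := by
      intro y
      rw [l2norm_smul, abs_of_pos (by positivity), ← zl2, inv_mul_le_iff₀ hr, mul_one]
    constructor
    · rintro ⟨hx, z, hz, rfl⟩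
      choose y hy using hz
      have hyz : (fun i => (y i : ℝ)) = z := by ext i; simpa using hy i
      refine ⟨y, ?_, by rw [hyz]⟩
      rw [← hyz, hnorm] at hx
      tauto
    · rintro ⟨y, hy, rfl⟩
      refine ⟨(hnorm y).2 ?_, _, fun i => ⟨y i, by simp⟩, rfl⟩
      rcases hy with rfl | hy
      · rw [zl2_zero]; exact hr.le
      · exact hy.2
  have hinj : Function.Injective (fun (y : Fin d → ℤ) => r⁻¹ • (fun i => (y i : ℝ))) := by
    intro y z hyz
    have := smul_right_injective _ (inv_ne_zero hr.ne') hyz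
    ext i
    exact_mod_cast congrFun this i
  rw [himg, Nat.card_coe_set_eq, Set.ncard_image_of_injective _ hinj, Set.ncard_coe_finset, hcard]
  push_cast
  rfl

lemma exists_card_latBall_le (d : ℕ) [NeZero d] :
    ∃ C : ℝ, 0 < C ∧ ∀ r : ℝ, 0 ≤ r → ((latBall d r).card : ℝ) ≤ C * r ^ d := by
  have h := (tendsto_card_latBall d).eventually_lt_const (lt_add_one _)
  obtain ⟨r₀, hr₀⟩ := eventually_atTop.1 h
  have hV := unitBallVol_pos d
  refine ⟨max (unitBallVol d + 1) ((latBall d r₀).card : ℝ), by positivity, fun r hr => ?_⟩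
  rcases lt_or_ge r 1 with h1 | h1
  · rw [latBall_eq_empty h1]
    simp only [Finset.card_empty, Nat.cast_zero]
    positivity
  rcases le_total r₀ r with h2 | h2
  · have := hr₀ r h2
    rw [div_lt_iff₀ (by positivity)] at this
    exact this.le.trans (by gcongr; exact le_max_left _ _)
  · have : ((latBall d r).card : ℝ) ≤ (latBall d r₀).card := by
      exact_mod_cast Finset.card_le_card (latBall_mono h2)
    calc _ ≤ ((latBall d r₀).card : ℝ) * 1 := by simpa using this
      _ ≤ _ := by
        gcongr
        · exact le_max_right _ _
        · exact one_le_pow₀ h1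

lemma integral_mul_inv_pow_succ (k : ℕ) {a b : ℝ} (ha : 0 < a) (hab : a ≤ b) :
    ∫ r in a..b, (k : ℝ) * (r ^ (k + 1))⁻¹ = (a ^ k)⁻¹ - (b ^ k)⁻¹ := by
  have hpos : ∀ r ∈ Set.uIcc a b, 0 < r := fun r hr => by
    rw [Set.uIcc_of_le hab] at hr
    exact ha.trans_le hr.1
  rw [intervalIntegral.integral_eq_sub_of_hasDerivAt (f := fun r => -(r ^ k)⁻¹)]
  · ring
  · intro r hr
    have h0 := hpos r hr
    have := ((hasDerivAt_pow k r).inv (by positivity)).neg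
    refine this.congr_deriv ?_
    rcases k with _ | k
    · simp
    · simp only [Nat.add_sub_cancel]
      field_simp
      ring
  · refine ContinuousOn.intervalIntegrable fun r hr => ContinuousAt.continuousWithinAt ?_
    have h0 := hpos r hr
    have : r ^ (k + 1) ≠ 0 := by positivity
    fun_prop (disch := assumption)

/-- Truncated lattice sums `∑_{0 < ‖y‖ ≤ R} ‖y‖⁻ᵏ`. -/
noncomputable def powSum (d k : ℕ) (R : ℝ) : ℝ := ∑ y ∈ latBall d R, (zl2 y ^ k)⁻¹

lemma intervalIntegrable_card_latBall (d k : ℕ) {a b : ℝ} (ha : 0 < a) (hab : a ≤ b) :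
    IntervalIntegrable (fun r => ((latBall d r).card : ℝ) * ((k : ℝ) * (r ^ (k + 1))⁻¹))
      volume a b := by
  apply IntervalIntegrable.mul_continuousOn
  · apply Monotone.intervalIntegrable
    intro r s h
    simp only [Nat.cast_le]
    exact Finset.card_le_card (latBall_mono h)
  · intro r hr
    rw [Set.uIcc_of_le hab] at hr
    have h0 := ha.trans_le hr.1
    have : r ^ (k + 1) ≠ 0 := by positivity
    apply ContinuousAt.continuousWithinAt
    fun_prop (disch := assumption)

lemma integral_ite_mul_inv_pow_succ (k : ℕ) {n R : ℝ} (hn : 1 ≤ n) (hnR : n ≤ R) :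
    IntervalIntegrable (fun r => (if n ≤ r then (1 : ℝ) else 0) * ((k : ℝ) * (r ^ (k + 1))⁻¹))
      volume 1 R ∧
    ∫ r in (1 : ℝ)..R, (if n ≤ r then (1 : ℝ) else 0) * ((k : ℝ) * (r ^ (k + 1))⁻¹)
      = (n ^ k)⁻¹ - (R ^ k)⁻¹ := by
  have hint : IntervalIntegrable
      (fun r => (if n ≤ r then (1 : ℝ) else 0) * ((k : ℝ) * (r ^ (k + 1))⁻¹)) volume 1 R := by
    apply IntervalIntegrable.mul_continuousOn
    · apply Monotone.intervalIntegrable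
      intro r s h
      by_cases h1 : n ≤ r
      · simp [h1, h1.trans h]
      · simp only [h1, if_false]
        positivity
    · intro r hr
      rw [Set.uIcc_of_le (hn.trans hnR)] at hr
      have h0 := one_pos.trans_le hr.1
      have : r ^ (k + 1) ≠ 0 := by positivity
      apply ContinuousAt.continuousWithinAt
      fun_prop (disch := assumption)
  refine ⟨hint, ?_⟩
  have hmem : n ∈ Set.uIcc 1 R := by rw [Set.uIcc_of_le (hn.trans hnR)]; exact ⟨hn, hnR⟩
  rw [← intervalIntegral.integral_add_adjacent_intervals
    (hint.mono_set (Set.uIcc_subset_uIcc_left hmem))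
    (hint.mono_set (Set.uIcc_subset_uIcc_right hmem))]
  have h1 : ∫ r in (1 : ℝ)..n, (if n ≤ r then (1 : ℝ) else 0) * ((k : ℝ) * (r ^ (k + 1))⁻¹) = 0 := by
    rw [intervalIntegral.integral_of_le hn, integral_Ioc_eq_integral_Ioo]
    apply setIntegral_eq_zero_of_forall_eq_zero
    intro r hr
    simp [hr.2.not_ge]
  rw [h1, zero_add, ← integral_mul_inv_pow_succ k (by linarith) hnR]
  apply intervalIntegral.integral_congr
  intro r hr
  rw [Set.uIcc_of_le hnR] at hr
  simp [hr.1]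

lemma powSum_eq (d k : ℕ) {R : ℝ} (hR : 1 ≤ R) :
    powSum d k R = (latBall d R).card * (R ^ k)⁻¹ +
      ∫ r in (1 : ℝ)..R, ((latBall d r).card : ℝ) * ((k : ℝ) * (r ^ (k + 1))⁻¹) := by
  have h1 : ∫ r in (1 : ℝ)..R, ((latBall d r).card : ℝ) * ((k : ℝ) * (r ^ (k + 1))⁻¹) =
      ∫ r in (1 : ℝ)..R, ∑ y ∈ latBall d R,
        (if zl2 y ≤ r then (1 : ℝ) else 0) * ((k : ℝ) * (r ^ (k + 1))⁻¹) := by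
    apply intervalIntegral.integral_congr
    intro r hr
    rw [Set.uIcc_of_le hR] at hr
    simp only [← Finset.sum_mul]
    congr 1
    rw [Finset.sum_boole, Nat.cast_inj]
    congr 1
    ext y
    simp only [mem_latBall, Finset.mem_filter]
    constructor
    · exact fun h => ⟨⟨h.1, h.2.trans hr.2⟩, h.2⟩
    · exact fun h => ⟨h.1.1, h.2⟩
  have h2 : ∀ y ∈ latBall d R, 1 ≤ zl2 y ∧ zl2 y ≤ R := fun y hy => by
    rw [mem_latBall] at hy
    exact ⟨one_le_zl2 hy.1, hy.2⟩
  rw [h1, intervalIntegral.integral_finsetSum fun y hy =>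
      (integral_ite_mul_inv_pow_succ k (h2 y hy).1 (h2 y hy).2).1,
    Finset.sum_congr rfl fun y hy =>
      (integral_ite_mul_inv_pow_succ k (h2 y hy).1 (h2 y hy).2).2,
    Finset.sum_sub_distrib, powSum]
  simp

lemma powSum_sub (d k : ℕ) {R S : ℝ} (hR : 1 ≤ R) (hS : R ≤ S) :
    powSum d k S - powSum d k R =
      (latBall d S).card * (S ^ k)⁻¹ - (latBall d R).card * (R ^ k)⁻¹ +
      ∫ r in R..S, ((latBall d r).card : ℝ) * ((k : ℝ) * (r ^ (k + 1))⁻¹) := by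
  rw [powSum_eq d k hR, powSum_eq d k (hR.trans hS),
    ← intervalIntegral.integral_add_adjacent_intervals
      (intervalIntegrable_card_latBall d k one_pos hR)
      (intervalIntegrable_card_latBall d k (by linarith) hS)]
  ring

lemma exists_tail_sum_le (d : ℕ) [NeZero d] :
    ∃ C : ℝ, 0 < C ∧ ∀ R : ℝ, 1 ≤ R → ∀ s : Finset (Fin d → ℤ), (∀ y ∈ s, R < zl2 y) →
      ∑ y ∈ s, (zl2 y ^ (d + 2))⁻¹ ≤ C * (R ^ 2)⁻¹ := by
  obtain ⟨C, hC, hcard⟩ := exists_card_latBall_le d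
  refine ⟨C * (1 + (d + 2) / 2), by positivity, fun R hR s hs => ?_⟩
  obtain ⟨S, hS⟩ : ∃ S : ℝ, ∀ y ∈ s, zl2 y ≤ S := by
    refine ⟨∑ y ∈ s, zl2 y, fun y hy => Finset.single_le_sum (fun y _ => zl2_nonneg y) hy⟩
  wlog hRS : R ≤ S generalizing S
  · exact this (max R S) (fun y hy => (hS y hy).trans (le_max_right _ _)) (le_max_left _ _)
  have hR0 : 0 < R := by linarith
  have hS0 : 0 < S := by linarith
  have h1 : ∑ y ∈ s, (zl2 y ^ (d + 2))⁻¹ ≤ powSum d (d + 2) S - powSum d (d + 2) R := by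
    rw [powSum, powSum, ← Finset.sum_sdiff_eq_sub (latBall_mono hRS)]
    apply Finset.sum_le_sum_of_subset_of_nonneg
    · intro y hy
      have hy0 : y ≠ 0 := by
        rintro rfl
        have := hs _ hy
        rw [zl2_zero] at this
        linarith
      simp only [Finset.mem_sdiff, mem_latBall]
      exact ⟨⟨hy0, hS y hy⟩, fun h => (hs y hy).not_ge h.2⟩
    · intro y _ _
      have := zl2_nonneg y
      positivity
  refine h1.trans ?_
  rw [powSum_sub d (d + 2) hR hRS]
  have h2 : (latBall d S).card * (S ^ (d + 2))⁻¹ ≤ C * (R ^ 2)⁻¹ := by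
    calc _ ≤ (C * S ^ d) * (S ^ (d + 2))⁻¹ := by gcongr; exact hcard S hS0.le
      _ = C * (S ^ 2)⁻¹ := by field_simp; ring
      _ ≤ _ := by gcongr
  have h3 : 0 ≤ (latBall d R).card * (R ^ (d + 2))⁻¹ := by positivity
  have h4 : ∫ r in R..S, ((latBall d r).card : ℝ) * (((d + 2 : ℕ) : ℝ) * (r ^ (d + 2 + 1))⁻¹) ≤
      ∫ r in R..S, C * (d + 2) / 2 * (((2 : ℕ) : ℝ) * (r ^ (2 + 1))⁻¹) := by
    apply intervalIntegral.integral_mono_on hRS (intervalIntegrable_card_latBall d _ hR0 hRS)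
    · refine ContinuousOn.intervalIntegrable fun r hr => ContinuousAt.continuousWithinAt ?_
      rw [Set.uIcc_of_le hRS] at hr
      have h0 := hR0.trans_le hr.1
      have : r ^ (2 + 1) ≠ 0 := by positivity
      fun_prop (disch := assumption)
    · intro r hr
      have h0 := hR0.trans_le hr.1
      calc _ ≤ (C * r ^ d) * (((d + 2 : ℕ) : ℝ) * (r ^ (d + 2 + 1))⁻¹) := by
            gcongr; exact hcard r h0.le
        _ = _ := by push_cast; field_simp; ring
  rw [intervalIntegral.integral_const_mul, integral_mul_inv_pow_succ 2 hR0 hRS] at h4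
  have h5 : C * (d + 2) / 2 * ((R ^ 2)⁻¹ - (S ^ 2)⁻¹) ≤ C * (d + 2) / 2 * (R ^ 2)⁻¹ := by
    gcongr
    have : 0 ≤ (S ^ 2)⁻¹ := by positivity
    linarith
  linarith

lemma summable_inv_zl2_pow (d : ℕ) [NeZero d] :
    Summable (fun y : Fin d → ℤ => (zl2 y ^ (d + 2))⁻¹) := by
  obtain ⟨C, hC, h⟩ := exists_tail_sum_le d
  refine summable_of_sum_le (c := powSum d (d + 2) 1 + C * (1 ^ 2)⁻¹)
    (fun y => by have := zl2_nonneg y; positivity) fun s => ?_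
  classical
  rw [← Finset.sum_filter_add_sum_filter_not s (fun y => zl2 y ≤ 1)]
  gcongr
  · rw [powSum]
    have h0 : ∑ y ∈ s.filter (fun y => zl2 y ≤ 1), (zl2 y ^ (d + 2))⁻¹ =
        ∑ y ∈ (s.filter (fun y => zl2 y ≤ 1)).erase 0, (zl2 y ^ (d + 2))⁻¹ := by
      rw [Finset.sum_erase]
      simp [zl2_zero]
    rw [h0]
    apply Finset.sum_le_sum_of_subset_of_nonneg
    · intro y hy
      simp only [Finset.mem_erase, Finset.mem_filter] at hy
      exact mem_latBall.2 ⟨hy.1, hy.2.2⟩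
    · intro y _ _
      have := zl2_nonneg y
      positivity
  · apply h 1 le_rfl
    intro y hy
    simpa using (Finset.mem_filter.1 hy).2

lemma tendsto_integral_mul_inv_div_log {g : ℝ → ℝ} {V : ℝ} (hg : Tendsto g atTop (𝓝 V))
    (hint : ∀ a b : ℝ, 0 < a → a ≤ b → IntervalIntegrable (fun r => g r * r⁻¹) volume a b) :
    Tendsto (fun R => (∫ r in (1 : ℝ)..R, g r * r⁻¹) / Real.log R) atTop (𝓝 V) := by
  rw [Metric.tendsto_atTop]
  intro ε hε
  obtain ⟨r₀, hr₀⟩ := Metric.tendsto_atTop.1 hg (ε / 2) (by positivity)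
  wlog h1 : 1 ≤ r₀ generalizing r₀
  · exact this (max 1 r₀) (fun r hr => hr₀ r ((le_max_right _ _).trans hr)) (le_max_left _ _)
  have hr0 : 0 < r₀ := by linarith
  set K : ℝ := |∫ r in (1 : ℝ)..r₀, g r * r⁻¹| + |V| * Real.log r₀ with hK
  have hev : ∀ᶠ R in atTop, r₀ ≤ R ∧ 1 < R ∧ K < ε / 2 * Real.log R := by
    refine (eventually_ge_atTop r₀).and ((eventually_gt_atTop 1).and ?_)
    exact (Real.tendsto_log_atTop.const_mul_atTop (half_pos hε)).eventually_gt_atTop K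
  obtain ⟨R₁, hR₁⟩ := eventually_atTop.1 hev
  refine ⟨R₁, fun R hR => ?_⟩
  obtain ⟨hRr, hR1, hKR⟩ := hR₁ R hR
  have hlog : 0 < Real.log R := Real.log_pos hR1
  have hlog0 : 0 ≤ Real.log r₀ := Real.log_nonneg h1
  have hR0 : 0 < R := by linarith
  have hinv : IntervalIntegrable (fun r : ℝ => r⁻¹) volume r₀ R := by
    refine ContinuousOn.intervalIntegrable fun r hr => ContinuousAt.continuousWithinAt ?_
    rw [Set.uIcc_of_le hRr] at hr
    exact continuousAt_inv₀ (hr0.trans_le hr.1).ne'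
  have hI : ∫ r in r₀..R, r⁻¹ = Real.log R - Real.log r₀ := by
    rw [integral_inv_of_pos hr0 hR0, Real.log_div hR0.ne' hr0.ne']
  have hb : |∫ r in r₀..R, (g r * r⁻¹ - V * r⁻¹)| ≤ ε / 2 * (Real.log R - Real.log r₀) := by
    rw [← hI, ← intervalIntegral.integral_const_mul, ← Real.norm_eq_abs]
    refine intervalIntegral.norm_integral_le_of_norm_le hRr ?_ (hinv.const_mul _)
    refine ae_of_all _ fun r hr => ?_
    have hrpos : 0 < r := hr0.trans hr.1
    rw [← sub_mul, norm_mul, Real.norm_eq_abs r⁻¹, abs_of_pos (inv_pos.2 hrpos)]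
    gcongr
    exact (hr₀ r hr.1.le).le
  rw [intervalIntegral.integral_sub (hint _ _ hr0 hRr) (hinv.const_mul _),
    intervalIntegral.integral_const_mul, hI] at hb
  rw [Real.dist_eq, ← intervalIntegral.integral_add_adjacent_intervals (hint _ _ one_pos h1)
    (hint _ _ hr0 hRr), div_sub' hlog.ne', abs_div, abs_of_pos hlog, div_lt_iff₀ hlog]
  set A := ∫ r in (1 : ℝ)..r₀, g r * r⁻¹
  set B := ∫ r in r₀..R, g r * r⁻¹
  have e : A + B - Real.log R * V =
      A - V * Real.log r₀ + (B - V * (Real.log R - Real.log r₀)) := by ring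
  rw [e]
  have h3 : |A - V * Real.log r₀| ≤ K := by
    refine (abs_sub _ _).trans ?_
    rw [abs_mul, abs_of_nonneg hlog0]
  have h4 := abs_add_le (A - V * Real.log r₀) (B - V * (Real.log R - Real.log r₀))
  have h5 : 0 ≤ ε / 2 * Real.log r₀ := by positivity
  linarith

lemma tendsto_powSum_div_log (d : ℕ) [NeZero d] :
    Tendsto (fun R => powSum d d R / Real.log R) atTop (𝓝 (d * unitBallVol d)) := by
  have h1 : Tendsto (fun R => ((latBall d R).card : ℝ) / R ^ d / Real.log R) atTop (𝓝 0) :=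
    (tendsto_card_latBall d).div_atTop Real.tendsto_log_atTop
  have h2 := tendsto_integral_mul_inv_div_log ((tendsto_card_latBall d).const_mul (d : ℝ))
    (fun a b ha hab => by
      convert intervalIntegrable_card_latBall d d ha hab using 2 with r
      simp only [pow_succ, mul_inv, div_eq_mul_inv]
      ring)
  have h3 := h1.add h2
  rw [zero_add] at h3
  refine h3.congr' ?_
  filter_upwards [eventually_ge_atTop 1] with R hR
  rw [powSum_eq d d hR, ← add_div, div_eq_mul_inv]
  congr 2
  apply intervalIntegral.integral_congr
  intro r _
  simp only [pow_succ, mul_inv, div_eq_mul_inv]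
  ring

lemma zl2_sq {d : ℕ} (y : Fin d → ℤ) : zl2 y ^ 2 = ∑ i, (y i : ℝ) ^ 2 := l2norm_sq _

lemma sum_latBall_comp {d : ℕ} (R : ℝ) (e : (Fin d → ℤ) ≃ (Fin d → ℤ))
    (he0 : ∀ y, e y = 0 ↔ y = 0) (he : ∀ y, zl2 (e y) = zl2 y) (F : (Fin d → ℤ) → ℝ) :
    ∑ y ∈ latBall d R, F (e y) = ∑ y ∈ latBall d R, F y := by
  refine Finset.sum_equiv e (fun y => ?_) fun _ _ => rfl
  simp [mem_latBall, he, he0]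

lemma sum_latBall_mul_of_ne {d : ℕ} (R : ℝ) {i j : Fin d} (hij : i ≠ j) (w : ℝ → ℝ) :
    ∑ y ∈ latBall d R, (y i : ℝ) * (y j : ℝ) * w (zl2 y) = 0 := by
  let e : (Fin d → ℤ) ≃ (Fin d → ℤ) :=
    Equiv.piCongrRight fun k => if k = i then Equiv.neg ℤ else Equiv.refl ℤ
  have hek : ∀ y k, e y k = if k = i then - y k else y k := by
    intro y k
    by_cases h : k = i <;> simp [e, h]
  have he0 : ∀ y, e y = 0 ↔ y = 0 := by
    intro y
    simp only [funext_iff, hek, Pi.zero_apply]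
    refine forall_congr' fun k => ?_
    split_ifs <;> simp
  have he : ∀ y, zl2 (e y) = zl2 y := by
    intro y
    simp only [zl2, l2norm, hek]
    congr 1
    refine Finset.sum_congr rfl fun k _ => ?_
    split_ifs <;> simp
  have h := sum_latBall_comp R e he0 he (fun y => (y i : ℝ) * (y j : ℝ) * w (zl2 y))
  simp only [he, hek, if_true, hij.symm, if_false, Int.cast_neg, neg_mul,
    Finset.sum_neg_distrib] at h
  linarith

lemma sum_latBall_sq_eq {d : ℕ} (R : ℝ) (i j : Fin d) (w : ℝ → ℝ) :
    ∑ y ∈ latBall d R, (y i : ℝ) ^ 2 * w (zl2 y) =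
      ∑ y ∈ latBall d R, (y j : ℝ) ^ 2 * w (zl2 y) := by
  let e : (Fin d → ℤ) ≃ (Fin d → ℤ) := (Equiv.swap i j).arrowCongr (Equiv.refl ℤ)
  have hek : ∀ y k, e y k = y (Equiv.swap i j k) := by
    intro y k
    simp [e, Equiv.arrowCongr]
  have he0 : ∀ y, e y = 0 ↔ y = 0 := by
    intro y
    simp only [funext_iff, hek, Pi.zero_apply]
    exact ⟨fun h k => by simpa using h (Equiv.swap i j k), fun h k => h _⟩
  have he : ∀ y, zl2 (e y) = zl2 y := by
    intro y
    simp only [zl2, l2norm, hek]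
    congr 1
    exact Equiv.sum_comp (Equiv.swap i j) fun k => (y k : ℝ) ^ 2
  have h := sum_latBall_comp R e he0 he (fun y => (y j : ℝ) ^ 2 * w (zl2 y))
  simpa [he, hek] using h

lemma sum_latBall_quadratic {d : ℕ} [NeZero d] (R : ℝ) (θ : Fin d → ℝ) :
    ∑ y ∈ latBall d R, (∑ i, θ i * (y i : ℝ)) ^ 2 * (zl2 y ^ (d + 2))⁻¹ =
      l2norm θ ^ 2 / d * powSum d d R := by
  have hd : (d : ℝ) ≠ 0 := by exact_mod_cast NeZero.ne d
  set w : ℝ → ℝ := fun n => (n ^ (d + 2))⁻¹ with hw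
  have hdiag : ∀ i : Fin d, ∑ y ∈ latBall d R, (y i : ℝ) ^ 2 * w (zl2 y) = powSum d d R / d := by
    intro i
    have h1 : ∑ j : Fin d, ∑ y ∈ latBall d R, (y j : ℝ) ^ 2 * w (zl2 y) = powSum d d R := by
      rw [Finset.sum_comm, powSum]
      refine Finset.sum_congr rfl fun y hy => ?_
      have := zl2_pos (mem_latBall.1 hy).1
      rw [← Finset.sum_mul, ← zl2_sq, hw]
      field_simp
      ring
    rw [eq_div_iff hd, ← h1, Finset.sum_congr rfl fun j _ => sum_latBall_sq_eq R j i w]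
    simp [mul_comm]
  have hexp : ∀ y : Fin d → ℤ, (∑ i, θ i * (y i : ℝ)) ^ 2 * w (zl2 y) =
      ∑ i, ∑ j, θ i * θ j * ((y i : ℝ) * (y j : ℝ) * w (zl2 y)) := by
    intro y
    rw [pow_two, Finset.sum_mul_sum, Finset.sum_mul]
    refine Finset.sum_congr rfl fun i _ => ?_
    rw [Finset.sum_mul]
    refine Finset.sum_congr rfl fun j _ => ?_
    ring
  rw [Finset.sum_congr rfl fun y _ => hexp y, Finset.sum_comm]
  have hrow : ∀ i : Fin d, ∑ y ∈ latBall d R, ∑ j, θ i * θ j * ((y i : ℝ) * (y j : ℝ) * w (zl2 y)) =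
      θ i ^ 2 * (powSum d d R / d) := by
    intro i
    rw [Finset.sum_comm]
    simp only [← Finset.mul_sum]
    rw [Finset.sum_eq_single i
      (fun j _ hj => by rw [sum_latBall_mul_of_ne R hj.symm, mul_zero]) (by simp), ← hdiag i]
    simp only [pow_two]
  rw [Finset.sum_congr rfl fun i _ => hrow i, ← Finset.sum_mul, l2norm_sq]
  ring

/-- The negative of the symbol of the walk with `α = 2`. -/
noncomputable def levySymbol (d : ℕ) (θ : Fin d → ℝ) : ℝ :=
  ∑' y : Fin d → ℤ, (1 - Real.cos (∑ i, θ i * (y i : ℝ))) * (zl2 y ^ (d + 2))⁻¹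

lemma latticeSymbol_two (d : ℕ) (θ : Fin d → ℝ) : latticeSymbol d 2 θ = -levySymbol d θ := by
  have hs : Function.support (fun y : Fin d → ℤ =>
      -((1 - Real.cos (∑ i, θ i * (y i : ℝ))) * (zl2 y ^ (d + 2))⁻¹)) ⊆ {y | y ≠ 0} := by
    intro y hy h0
    rw [h0] at hy
    simp at hy
  rw [latticeSymbol, levySymbol, ← tsum_neg]
  refine Eq.trans (tsum_congr fun y => ?_) (tsum_subtype_eq_of_support_subset hs)
  have : (d : ℝ) + 2 = ((d + 2 : ℕ) : ℝ) := by push_cast; rfl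
  rw [this, Real.rpow_natCast]
  ring

lemma levyTerm_nonneg {d : ℕ} (θ : Fin d → ℝ) (y : Fin d → ℤ) :
    0 ≤ (1 - Real.cos (∑ i, θ i * (y i : ℝ))) * (zl2 y ^ (d + 2))⁻¹ := by
  have := zl2_nonneg y
  have := Real.cos_le_one (∑ i, θ i * (y i : ℝ))
  have : 0 ≤ 1 - Real.cos (∑ i, θ i * (y i : ℝ)) := by linarith
  positivity

lemma levyTerm_le {d : ℕ} (θ : Fin d → ℝ) (y : Fin d → ℤ) :
    (1 - Real.cos (∑ i, θ i * (y i : ℝ))) * (zl2 y ^ (d + 2))⁻¹ ≤ 2 * (zl2 y ^ (d + 2))⁻¹ := by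
  have := zl2_nonneg y
  gcongr
  linarith [Real.neg_one_le_cos (∑ i, θ i * (y i : ℝ))]

lemma summable_levyTerm {d : ℕ} [NeZero d] (θ : Fin d → ℝ) :
    Summable fun y : Fin d → ℤ =>
      (1 - Real.cos (∑ i, θ i * (y i : ℝ))) * (zl2 y ^ (d + 2))⁻¹ :=
  Summable.of_nonneg_of_le (levyTerm_nonneg θ) (levyTerm_le θ)
    ((summable_inv_zl2_pow d).mul_left 2)

lemma levySymbol_nonneg {d : ℕ} (θ : Fin d → ℝ) : 0 ≤ levySymbol d θ :=
  tsum_nonneg (levyTerm_nonneg θ)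

lemma continuous_levySymbol (d : ℕ) [NeZero d] : Continuous (levySymbol d) := by
  refine continuous_tsum (fun y => by fun_prop) ((summable_inv_zl2_pow d).mul_left 2) ?_
  intro y θ
  rw [Real.norm_eq_abs, abs_of_nonneg (levyTerm_nonneg θ y)]
  exact levyTerm_le θ y

lemma sum_le_levySymbol {d : ℕ} [NeZero d] (θ : Fin d → ℝ) (s : Finset (Fin d → ℤ)) :
    ∑ y ∈ s, (1 - Real.cos (∑ i, θ i * (y i : ℝ))) * (zl2 y ^ (d + 2))⁻¹ ≤ levySymbol d θ :=
  (summable_levyTerm θ).sum_le_tsum s fun y _ => levyTerm_nonneg θ y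

lemma le_levySymbol {d : ℕ} [NeZero d] (θ : Fin d → ℝ) {η R : ℝ} (hη : η ≤ 1)
    (hR : l2norm θ * R ≤ η) :
    (1 - η ^ 2) / 2 * (l2norm θ ^ 2 / d * powSum d d R) ≤ levySymbol d θ := by
  refine le_trans ?_ (sum_le_levySymbol θ (latBall d R))
  rw [← sum_latBall_quadratic, Finset.mul_sum]
  refine Finset.sum_le_sum fun y hy => ?_
  rw [← mul_assoc]
  have := zl2_nonneg y
  gcongr
  set u := ∑ i, θ i * (y i : ℝ)
  have hu : |u| ≤ η := by
    refine (abs_sum_mul_le θ (fun i => (y i : ℝ))).trans (le_trans ?_ hR)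
    exact mul_le_mul_of_nonneg_left (mem_latBall.1 hy).2 (l2norm_nonneg _)
  have h1 := (abs_le.1 (Real.cos_bound (hu.trans hη))).2
  have h2 : u ^ 2 ≤ η ^ 2 := by
    rw [← sq_abs u]
    gcongr
  have h3 : |u| ^ 4 = u ^ 2 * u ^ 2 := by
    rw [← sq_abs u]; ring
  have h4 : u ^ 2 * u ^ 2 ≤ u ^ 2 * η ^ 2 := by gcongr
  have h5 : 0 ≤ u ^ 2 * η ^ 2 := by positivity
  rw [h3] at h1
  nlinarith

lemma exists_levySymbol_le (d : ℕ) [NeZero d] :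
    ∃ C : ℝ, 0 < C ∧ ∀ (θ : Fin d → ℝ) (R : ℝ), 1 ≤ R →
      levySymbol d θ ≤ 1 / 2 * (l2norm θ ^ 2 / d * powSum d d R) + C * (R ^ 2)⁻¹ := by
  obtain ⟨C, hC, h⟩ := exists_tail_sum_le d
  refine ⟨2 * C, by positivity, fun θ R hR => ?_⟩
  refine (summable_levyTerm θ).tsum_le_of_sum_le fun s => ?_
  classical
  rw [← Finset.sum_filter_add_sum_filter_not s (fun y => y ∈ latBall d R)]
  gcongr
  · rw [← sum_latBall_quadratic, Finset.mul_sum]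
    refine (Finset.sum_le_sum_of_subset_of_nonneg
      (fun y hy => (Finset.mem_filter.1 hy).2) fun y _ _ => levyTerm_nonneg θ y).trans ?_
    refine Finset.sum_le_sum fun y hy => ?_
    rw [← mul_assoc]
    have := zl2_nonneg y
    gcongr
    linarith [Real.one_sub_sq_div_two_le_cos (x := ∑ i, θ i * (y i : ℝ))]
  · have h0 : ∑ y ∈ s.filter (fun y => y ∉ latBall d R),
          (1 - Real.cos (∑ i, θ i * (y i : ℝ))) * (zl2 y ^ (d + 2))⁻¹ =
        ∑ y ∈ (s.filter (fun y => y ∉ latBall d R)).erase 0,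
          (1 - Real.cos (∑ i, θ i * (y i : ℝ))) * (zl2 y ^ (d + 2))⁻¹ := by
      rw [Finset.sum_erase]
      simp
    rw [h0, mul_assoc]
    refine (Finset.sum_le_sum fun y _ => levyTerm_le θ y).trans ?_
    rw [← Finset.mul_sum]
    gcongr
    refine h R hR _ fun y hy => ?_
    simp only [Finset.mem_erase, Finset.mem_filter, mem_latBall, not_and, not_le] at hy
    exact hy.2.2 hy.1

lemma le_levySymbol_of_abs_le_pi {d : ℕ} [NeZero d] {θ : Fin d → ℝ} (hθ : ∀ i, |θ i| ≤ Real.pi) :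
    2 / Real.pi ^ 2 * l2norm θ ^ 2 ≤ levySymbol d θ := by
  have hinj : Function.Injective (fun i : Fin d => (Pi.single i 1 : Fin d → ℤ)) := by
    intro i j hij
    by_contra hne
    have := congrFun hij i
    simp [hne] at this
  refine le_trans ?_ (sum_le_levySymbol θ (Finset.univ.map ⟨_, hinj⟩))
  rw [Finset.sum_map, l2norm_sq, Finset.mul_sum]
  refine Finset.sum_le_sum fun i _ => ?_
  have h1 : zl2 (Pi.single i 1 : Fin d → ℤ) = 1 := by
    simp [zl2, l2norm, Pi.single_apply]
  have h2 : ∑ k, θ k * ((Pi.single i 1 : Fin d → ℤ) k : ℝ) = θ i := by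
    simp [Pi.single_apply]
  simp only [Function.Embedding.coeFn_mk, h1, h2, one_pow, inv_one, mul_one]
  linarith [Real.cos_le_one_sub_mul_cos_sq (hθ i)]

lemma tendsto_powSum_mul_div_log (d : ℕ) [NeZero d] {η : ℝ} (hη : 0 < η) :
    Tendsto (fun R => powSum d d (η * R) / Real.log R) atTop (𝓝 (d * unitBallVol d)) := by
  have h1 := (tendsto_powSum_div_log d).comp (tendsto_id.const_mul_atTop hη)
  have h2 : Tendsto (fun R => 1 + Real.log η / Real.log R) atTop (𝓝 (1 + 0)) :=
    tendsto_const_nhds.add (tendsto_const_nhds.div_atTop Real.tendsto_log_atTop)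
  have h3 := h1.mul h2
  rw [add_zero, mul_one] at h3
  refine h3.congr' ?_
  filter_upwards [eventually_gt_atTop 1, eventually_gt_atTop (1 / η)] with R hR hR'
  have hl : 0 < Real.log R := Real.log_pos hR
  have hl' : 0 < Real.log (η * R) := Real.log_pos (by rwa [div_lt_iff₀' hη] at hR')
  have e : Real.log (η * R) = Real.log η + Real.log R := Real.log_mul hη.ne' (by linarith)
  simp only [Function.comp, id]
  rw [show 1 + Real.log η / Real.log R = Real.log (η * R) / Real.log R by
    rw [e]; field_simp; ring]
  field_simp

/-- Uniform asymptotics of the symbol at the origin. -/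
lemma levySymbol_asymptotics (d : ℕ) [NeZero d] {ε : ℝ} (hε : 0 < ε) :
    ∃ R₀ : ℝ, 1 < R₀ ∧ ∀ (θ : Fin d → ℝ) (R : ℝ), R₀ ≤ R → l2norm θ * R = 1 →
      |levySymbol d θ - unitBallVol d / 2 * (l2norm θ ^ 2 * Real.log R)| ≤
        ε * (l2norm θ ^ 2 * Real.log R) := by
  obtain ⟨C, hC, hup⟩ := exists_levySymbol_le d
  have hV := unitBallVol_pos d
  have hd1 : (1 : ℝ) ≤ d := by exact_mod_cast NeZero.one_le
  set V := unitBallVol d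
  set η : ℝ := min 1 (ε / V)
  have hη : 0 < η := lt_min one_pos (by positivity)
  have hη1 : η ≤ 1 := min_le_left _ _
  have hηV : η ^ 2 * V ≤ ε := by
    have : η * V ≤ ε := by rw [← le_div_iff₀ hV]; exact min_le_right _ _
    nlinarith
  have h1 := (tendsto_powSum_mul_div_log d hη).eventually_const_le
    (show (d : ℝ) * V - ε < d * V by linarith)
  have h2 := (tendsto_powSum_div_log d).eventually_le_const
    (show (d : ℝ) * V < d * V + ε by linarith)
  have h3 := (Real.tendsto_log_atTop.const_mul_atTop (half_pos hε)).eventually_ge_atTop C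
  obtain ⟨R₁, hR₁⟩ := eventually_atTop.1 (h1.and (h2.and h3))
  refine ⟨max 2 R₁, by simp, fun θ R hR hθ => ?_⟩
  obtain ⟨b1, b2, b3⟩ := hR₁ R ((le_max_right _ _).trans hR)
  have hR2 : 2 ≤ R := (le_max_left _ _).trans hR
  have hlog : 0 < Real.log R := Real.log_pos (by linarith)
  rw [le_div_iff₀ hlog] at b1
  rw [div_le_iff₀ hlog] at b2
  have lo := le_levySymbol θ (η := η) (R := η * R) hη1
    (by rw [mul_left_comm, hθ, mul_one])
  have hi := hup θ R (by linarith)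
  set h := l2norm θ
  have hh : (R ^ 2)⁻¹ = h ^ 2 := by
    rw [← inv_pow]; congr 1
    exact (eq_inv_of_mul_eq_one_left hθ).symm
  rw [hh] at hi
  set ℓ := Real.log R
  rw [abs_le]
  have hd0 : (0 : ℝ) < d := by linarith
  have hdd : ε / (2 * d) ≤ ε / 2 := by gcongr; linarith
  constructor
  · have hη2 : η ^ 2 ≤ 1 := by nlinarith
    have c1 : (1 - η ^ 2) / 2 * (h ^ 2 / d * ((d * V - ε) * ℓ)) ≤
        (1 - η ^ 2) / 2 * (h ^ 2 / d * powSum d d (η * R)) := by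
      have : 0 ≤ 1 - η ^ 2 := by linarith
      gcongr
    have c2 : (1 - η ^ 2) / 2 * (h ^ 2 / d * ((d * V - ε) * ℓ)) =
        ((1 - η ^ 2) * (V / 2) - (1 - η ^ 2) * (ε / (2 * d))) * (h ^ 2 * ℓ) := by
      field_simp
    have c3 : V / 2 - ε ≤ (1 - η ^ 2) * (V / 2) - (1 - η ^ 2) * (ε / (2 * d)) := by
      have : 0 ≤ ε / (2 * d) := by positivity
      nlinarith
    have c4 : (V / 2 - ε) * (h ^ 2 * ℓ) ≤
        ((1 - η ^ 2) * (V / 2) - (1 - η ^ 2) * (ε / (2 * d))) * (h ^ 2 * ℓ) := by gcongr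
    linarith
  · have c1 : 1 / 2 * (h ^ 2 / d * powSum d d R) ≤ 1 / 2 * (h ^ 2 / d * ((d * V + ε) * ℓ)) := by
      gcongr
    have c2 : 1 / 2 * (h ^ 2 / d * ((d * V + ε) * ℓ)) =
        (V / 2 + ε / (2 * d)) * (h ^ 2 * ℓ) := by
      field_simp
    have c3 : C * h ^ 2 ≤ ε / 2 * ℓ * h ^ 2 := by gcongr
    have c4 : (V / 2 + ε / (2 * d)) * (h ^ 2 * ℓ) ≤ (V / 2 + ε / 2) * (h ^ 2 * ℓ) := by gcongr
    linarith

lemma levySymbol_zero (d : ℕ) : levySymbol d 0 = 0 := by simp [levySymbol]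

lemma tendsto_mul_levySymbol {d : ℕ} [NeZero d] (η : Fin d → ℝ) :
    Tendsto (fun N : ℝ => N * levySymbol d ((√(N * Real.log N))⁻¹ • η)) atTop
      (𝓝 (unitBallVol d / 4 * l2norm η ^ 2)) := by
  set a := l2norm η with ha
  rcases (l2norm_nonneg η).eq_or_lt' with h0 | h0
  · have hη : η = 0 := by
      ext i
      have := abs_apply_le_l2norm η i
      rw [h0] at this
      exact abs_nonpos_iff.1 this
    rw [ha, h0, hη]
    simp [levySymbol_zero]
  rw [← ha] at h0
  have hX : Tendsto (fun N : ℝ => a ^ 2 * (Real.log (√(N * Real.log N) / a) / Real.log N)) atTop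
      (𝓝 (a ^ 2 * (1 / 2))) := by
    have h1 : Tendsto (fun N : ℝ => Real.log (Real.log N) / Real.log N) atTop (𝓝 0) :=
      Real.isLittleO_log_id_atTop.tendsto_div_nhds_zero.comp Real.tendsto_log_atTop
    have h2 : Tendsto (fun N : ℝ => Real.log a / Real.log N) atTop (𝓝 0) :=
      tendsto_const_nhds.div_atTop Real.tendsto_log_atTop
    have h3 := ((h1.const_mul (1 / 2)).const_add (1 / 2)).sub h2
    rw [mul_zero, add_zero, sub_zero] at h3
    refine (h3.congr' ?_).const_mul _
    filter_upwards [eventually_gt_atTop 1] with N hN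
    have hl := Real.log_pos hN
    have hN0 : 0 < N := by linarith
    rw [Real.log_div (Real.sqrt_pos.2 (by positivity)).ne' h0.ne', Real.log_sqrt (by positivity),
      Real.log_mul hN0.ne' hl.ne']
    field_simp
  have hlo : (fun N : ℝ => N * levySymbol d ((√(N * Real.log N))⁻¹ • η) -
      unitBallVol d / 2 * (a ^ 2 * (Real.log (√(N * Real.log N) / a) / Real.log N))) =o[atTop]
      (fun N : ℝ => a ^ 2 * (Real.log (√(N * Real.log N) / a) / Real.log N)) := by
    rw [Asymptotics.isLittleO_iff]
    intro ε hε
    obtain ⟨R₀, hR₀, hR⟩ := levySymbol_asymptotics d hε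
    have hev : Tendsto (fun N : ℝ => √(N * Real.log N) / a) atTop atTop :=
      (Real.tendsto_sqrt_atTop.comp
        (tendsto_id.atTop_mul_atTop₀ Real.tendsto_log_atTop)).atTop_div_const h0
    filter_upwards [hev.eventually_ge_atTop R₀, eventually_gt_atTop 1] with N hN hN1
    have hl := Real.log_pos hN1
    have hN0 : 0 < N := by linarith
    have hs : 0 < √(N * Real.log N) := Real.sqrt_pos.2 (by positivity)
    have hss : √(N * Real.log N) ^ 2 = N * Real.log N := Real.sq_sqrt (by positivity)
    have hnorm : l2norm ((√(N * Real.log N))⁻¹ • η) = a / √(N * Real.log N) := by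
      rw [l2norm_smul, abs_of_pos (by positivity), ← ha]; ring
    have key := hR ((√(N * Real.log N))⁻¹ • η) _ hN (by rw [hnorm]; field_simp)
    rw [hnorm, div_pow, hss] at key
    have hY : 0 ≤ a ^ 2 * (Real.log (√(N * Real.log N) / a) / Real.log N) := by
      have := Real.log_nonneg (hR₀.le.trans hN)
      positivity
    rw [Real.norm_eq_abs, Real.norm_eq_abs, abs_of_nonneg hY]
    set ℓ := Real.log (√(N * Real.log N) / a)
    have e : a ^ 2 / (N * Real.log N) * ℓ = N⁻¹ * (a ^ 2 * (ℓ / Real.log N)) := by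
      field_simp
    rw [e] at key
    set Y := a ^ 2 * (ℓ / Real.log N)
    set Z := levySymbol d ((√(N * Real.log N))⁻¹ • η)
    have e2 : N * Z - unitBallVol d / 2 * Y = N * (Z - unitBallVol d / 2 * (N⁻¹ * Y)) := by
      field_simp
    rw [e2, abs_mul, abs_of_pos hN0]
    calc _ ≤ N * (ε * (N⁻¹ * Y)) := by gcongr
      _ = ε * Y := by field_simp
  have h0' := (Asymptotics.isLittleO_one_iff ℝ).1 (hlo.trans_isBigO (hX.isBigO_one ℝ))
  have h1 := h0'.add (hX.const_mul (unitBallVol d / 2))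
  simp only [sub_add_cancel, zero_add] at h1
  convert h1 using 2
  ring

lemma exists_le_mul_levySymbol (d : ℕ) [NeZero d] :
    ∃ c : ℝ, 0 < c ∧ c ≤ unitBallVol d / 4 ∧ ∀ᶠ N : ℝ in atTop, ∀ η : Fin d → ℝ,
      (∀ i, |((√(N * Real.log N))⁻¹ • η) i| ≤ Real.pi) →
        c * (l2norm η - 1) ≤ N * levySymbol d ((√(N * Real.log N))⁻¹ • η) := by
  have hV := unitBallVol_pos d
  set V := unitBallVol d
  obtain ⟨R₀, hR₀, hR⟩ := levySymbol_asymptotics d (show 0 < V / 4 by positivity)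
  set c : ℝ := min (V / 16) (1 / (2 * Real.pi ^ 2)) with hc
  have hcpos : 0 < c := by positivity
  have hcV : c ≤ V / 16 := min_le_left _ _
  refine ⟨c, hcpos, hcV.trans (by linarith), ?_⟩
  filter_upwards [eventually_ge_atTop (Real.exp 1), eventually_ge_atTop (R₀ ^ 4)] with N hN hNR η hη
  have hl : 1 ≤ Real.log N := by
    rw [Real.le_log_iff_exp_le ((Real.exp_pos 1).trans_le hN)]; exact hN
  have hN0 : 0 < N := (Real.exp_pos 1).trans_le hN
  have hl0 : 0 < Real.log N := by linarith
  have hs : 0 < √(N * Real.log N) := Real.sqrt_pos.2 (by positivity)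
  have hss : √(N * Real.log N) ^ 2 = N * Real.log N := Real.sq_sqrt (by positivity)
  have hnorm : l2norm ((√(N * Real.log N))⁻¹ • η) = l2norm η / √(N * Real.log N) := by
    rw [l2norm_smul, abs_of_pos (by positivity)]; ring
  obtain ⟨q, hq0, hq⟩ : ∃ q : ℝ, 0 < q ∧ q ^ 4 = N := by
    refine ⟨√(√N), by positivity, ?_⟩
    rw [show (4 : ℕ) = 2 * 2 from rfl, pow_mul, Real.sq_sqrt (by positivity),
      Real.sq_sqrt hN0.le]
  have hlq : Real.log N = 4 * Real.log q := by
    rw [← hq, Real.log_pow]; norm_num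
  have hqR : R₀ ≤ q := by
    rw [← hq] at hNR
    exact le_of_pow_le_pow_left₀ (by norm_num) hq0.le hNR
  have ha0 := l2norm_nonneg η
  set a := l2norm η
  set s := √(N * Real.log N)
  have hsq : q ^ 2 ≤ s := by
    apply Real.le_sqrt_of_sq_le
    rw [← pow_mul, hq]
    nlinarith
  rcases ha0.eq_or_lt with h0 | h0
  · rw [← h0]
    have := mul_nonneg hN0.le (levySymbol_nonneg (s⁻¹ • η))
    linarith
  rcases le_or_gt a q with haq | haq
  · have hqs : q ≤ s / a := by
      rw [le_div_iff₀ h0]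
      nlinarith
    have key := (abs_le.1 (hR (s⁻¹ • η) (s / a) (hqR.trans hqs)
      (by rw [hnorm]; field_simp))).1
    rw [hnorm, div_pow, hss] at key
    have h1 : Real.log N / 4 ≤ Real.log (s / a) := by
      rw [hlq, mul_div_cancel_left₀ _ (by norm_num)]
      exact Real.log_le_log hq0 hqs
    have h2 : V / 4 * (a ^ 2 / (N * Real.log N) * (Real.log N / 4)) ≤ levySymbol d (s⁻¹ • η) := by
      have : V / 4 * (a ^ 2 / (N * Real.log N) * (Real.log N / 4)) ≤
        V / 4 * (a ^ 2 / (N * Real.log N) * Real.log (s / a)) := by gcongr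
      linarith
    calc c * (a - 1) ≤ c * a ^ 2 := by
          gcongr
          nlinarith [sq_nonneg (a - 1)]
      _ ≤ V / 16 * a ^ 2 := by gcongr
      _ = N * (V / 4 * (a ^ 2 / (N * Real.log N) * (Real.log N / 4))) := by field_simp; norm_num
      _ ≤ _ := by gcongr
  · have key := le_levySymbol_of_abs_le_pi hη
    rw [hnorm, div_pow, hss] at key
    have h1 : Real.log N ≤ 4 * a := by
      rw [hlq]
      have := Real.log_le_sub_one_of_pos hq0
      linarith
    have h2 : a / 4 ≤ a ^ 2 / Real.log N := by
      rw [le_div_iff₀ hl0]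
      nlinarith
    calc c * (a - 1) ≤ c * a := by gcongr; linarith
      _ ≤ 1 / (2 * Real.pi ^ 2) * a := by gcongr; exact min_le_right _ _
      _ = 2 / Real.pi ^ 2 * (a / 4) := by field_simp; norm_num
      _ ≤ 2 / Real.pi ^ 2 * (a ^ 2 / Real.log N) := by gcongr
      _ = N * (2 / Real.pi ^ 2 * (a ^ 2 / (N * Real.log N))) := by field_simp
      _ ≤ _ := by gcongr

lemma integrable_exp_neg_mul_norm (d : ℕ) [NeZero d] {b : ℝ} (hb : 0 < b) :
    Integrable (fun η : Fin d → ℝ => Real.exp (-b * ‖η‖)) := by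
  rw [integrable_fun_norm_addHaar (volume : Measure (Fin d → ℝ))
    (f := fun r => Real.exp (-b * r))]
  have h := integrableOn_rpow_mul_exp_neg_mul_rpow (p := 1) (s := ((d - 1 : ℕ) : ℝ)) (b := b)
    (by have : (0 : ℝ) ≤ ((d - 1 : ℕ) : ℝ) := Nat.cast_nonneg _
        linarith) one_pos hb
  simpa using h

/-- The integrand of `pTrans d 2 (t * N)` without its oscillating factor, at the diffusive scale. -/
noncomputable def scaledChar (d : ℕ) (t N : ℝ) (η : Fin d → ℝ) : ℝ :=
  (Set.univ.pi fun _ : Fin d => Set.Icc (-Real.pi) Real.pi).indicator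
    (fun θ => Real.exp (-(t * (N * levySymbol d θ)))) ((√(N * Real.log N))⁻¹ • η)

lemma measurable_scaledChar (d : ℕ) [NeZero d] (t N : ℝ) : Measurable (scaledChar d t N) := by
  refine Measurable.comp (g := (Set.univ.pi fun _ : Fin d => Set.Icc (-Real.pi) Real.pi).indicator
    (fun θ => Real.exp (-(t * (N * levySymbol d θ))))) ?_ (measurable_const_smul _)
  refine Measurable.indicator ?_ (MeasurableSet.univ_pi fun _ => measurableSet_Icc)
  have := (continuous_levySymbol d).measurable
  fun_prop

lemma scaledChar_nonneg (d : ℕ) (t N : ℝ) (η : Fin d → ℝ) : 0 ≤ scaledChar d t N η :=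
  Set.indicator_nonneg (fun _ _ => (Real.exp_pos _).le) _

lemma mem_pi_Icc_iff {d : ℕ} {θ : Fin d → ℝ} {b : ℝ} :
    θ ∈ Set.univ.pi (fun _ : Fin d => Set.Icc (-b) b) ↔ ∀ i, |θ i| ≤ b := by
  simp only [Set.mem_pi, Set.mem_univ, true_implies, Set.mem_Icc, abs_le]

lemma norm_le_l2norm {d : ℕ} (u : Fin d → ℝ) : ‖u‖ ≤ l2norm u :=
  (pi_norm_le_iff_of_nonneg (l2norm_nonneg u)).2 (abs_apply_le_l2norm u)

lemma tendsto_sqrt_mul_log : Tendsto (fun N : ℝ => √(N * Real.log N)) atTop atTop :=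
  Real.tendsto_sqrt_atTop.comp (tendsto_id.atTop_mul_atTop₀ Real.tendsto_log_atTop)

lemma tendsto_scaledChar {d : ℕ} [NeZero d] (t : ℝ) (η : Fin d → ℝ) :
    Tendsto (fun N => scaledChar d t N η) atTop
      (𝓝 (Real.exp (-(t * (unitBallVol d / 4 * l2norm η ^ 2))))) := by
  have h := ((Real.continuous_exp.tendsto _).comp
    ((tendsto_mul_levySymbol η).const_mul t).neg)
  refine h.congr' ?_
  filter_upwards [tendsto_sqrt_mul_log.eventually_ge_atTop ‖η‖,
    tendsto_sqrt_mul_log.eventually_gt_atTop 0] with N hN hN0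
  rw [scaledChar, Set.indicator_of_mem]
  · rfl
  · rw [mem_pi_Icc_iff]
    intro i
    have h1 : |η i| ≤ √(N * Real.log N) := (norm_le_pi_norm η i).trans hN
    rw [Pi.smul_apply, smul_eq_mul, abs_mul, abs_of_pos (inv_pos.2 hN0)]
    calc _ ≤ (√(N * Real.log N))⁻¹ * √(N * Real.log N) := by gcongr
      _ = 1 := inv_mul_cancel₀ hN0.ne'
      _ ≤ Real.pi := by linarith [Real.pi_gt_three]

lemma exists_scaledChar_le (d : ℕ) [NeZero d] {t : ℝ} (ht : 0 < t) :
    ∃ c : ℝ, 0 < c ∧ (∀ η : Fin d → ℝ, Real.exp (-(t * (unitBallVol d / 4 * l2norm η ^ 2))) ≤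
        Real.exp (t * c) * Real.exp (-(t * c) * ‖η‖)) ∧
      ∀ᶠ N in atTop, ∀ η : Fin d → ℝ,
        scaledChar d t N η ≤ Real.exp (t * c) * Real.exp (-(t * c) * ‖η‖) := by
  obtain ⟨c, hc, hcV, hev⟩ := exists_le_mul_levySymbol d
  have aux : ∀ (η : Fin d → ℝ) (z : ℝ), c * (l2norm η - 1) ≤ z →
      Real.exp (-(t * z)) ≤ Real.exp (t * c) * Real.exp (-(t * c) * ‖η‖) := by
    intro η z hz
    rw [← Real.exp_add, Real.exp_le_exp]
    have h1 : c * (‖η‖ - 1) ≤ z := le_trans (by gcongr; exact norm_le_l2norm η) hz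
    nlinarith
  refine ⟨c, hc, fun η => aux η _ ?_, ?_⟩
  · calc c * (l2norm η - 1) ≤ c * l2norm η ^ 2 := by
          gcongr
          nlinarith [sq_nonneg (l2norm η - 1), l2norm_nonneg η]
      _ ≤ _ := by gcongr
  · filter_upwards [hev] with N hN η
    rw [scaledChar]
    by_cases hη : (√(N * Real.log N))⁻¹ • η ∈
        Set.univ.pi (fun _ : Fin d => Set.Icc (-Real.pi) Real.pi)
    · rw [Set.indicator_of_mem hη]
      exact aux η _ (hN η (mem_pi_Icc_iff.1 hη))
    · rw [Set.indicator_of_notMem hη]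
      positivity

lemma integrable_gaussian_l2norm (d : ℕ) [NeZero d] {t : ℝ} (ht : 0 < t) :
    Integrable fun η : Fin d → ℝ => Real.exp (-(t * (unitBallVol d / 4 * l2norm η ^ 2))) := by
  obtain ⟨c, hc, hle, -⟩ := exists_scaledChar_le d ht
  refine ((integrable_exp_neg_mul_norm d (mul_pos ht hc)).const_mul (Real.exp (t * c))).mono'
    ?_ (ae_of_all _ fun η => ?_)
  · have := continuous_l2norm (d := d)
    exact (by fun_prop : Continuous _).aestronglyMeasurable
  · rw [Real.norm_eq_abs, abs_of_pos (Real.exp_pos _)]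
    exact hle η

lemma eventually_integrable_scaledChar (d : ℕ) [NeZero d] {t : ℝ} (ht : 0 < t) :
    ∀ᶠ N in atTop, Integrable (scaledChar d t N) := by
  obtain ⟨c, hc, -, hev⟩ := exists_scaledChar_le d ht
  filter_upwards [hev] with N hN
  refine ((integrable_exp_neg_mul_norm d (mul_pos ht hc)).const_mul (Real.exp (t * c))).mono'
    (measurable_scaledChar d t N).aestronglyMeasurable (ae_of_all _ fun η => ?_)
  rw [Real.norm_eq_abs, abs_of_nonneg (scaledChar_nonneg d t N η)]
  exact hN η

lemma tendsto_integral_abs_scaledChar_sub (d : ℕ) [NeZero d] {t : ℝ} (ht : 0 < t) :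
    Tendsto (fun N => ∫ η : Fin d → ℝ, |scaledChar d t N η -
      Real.exp (-(t * (unitBallVol d / 4 * l2norm η ^ 2)))|) atTop (𝓝 0) := by
  obtain ⟨c, hc, hle, hev⟩ := exists_scaledChar_le d ht
  rw [← integral_zero (Fin d → ℝ) ℝ]
  refine tendsto_integral_filter_of_dominated_convergence
    (fun η => Real.exp (t * c) * Real.exp (-(t * c) * ‖η‖)) ?_ ?_
    ((integrable_exp_neg_mul_norm d (mul_pos ht hc)).const_mul _) ?_
  · refine Eventually.of_forall fun N => Measurable.aestronglyMeasurable ?_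
    have h1 := measurable_scaledChar d t N
    have h2 := (continuous_l2norm (d := d)).measurable
    fun_prop
  · filter_upwards [hev] with N hN
    refine ae_of_all _ fun η => ?_
    rw [Real.norm_eq_abs, abs_abs, abs_le]
    have h1 := scaledChar_nonneg d t N η
    have h2 := (Real.exp_pos (-(t * (unitBallVol d / 4 * l2norm η ^ 2)))).le
    have h3 := hN η
    have h4 := hle η
    constructor <;> linarith
  · refine ae_of_all _ fun η => ?_
    have := ((tendsto_scaledChar t η).sub_const
      (Real.exp (-(t * (unitBallVol d / 4 * l2norm η ^ 2))))).abs
    simpa using this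

lemma pTrans_two_eq (d : ℕ) {t N : ℝ} (hN : 1 < N) (x : Fin d → ℤ) :
    (N * Real.log N) ^ ((d : ℝ) / 2) * pTrans d 2 (t * N) x =
      ((2 * Real.pi) ^ d)⁻¹ * ∫ η : Fin d → ℝ, scaledChar d t N η *
        Real.cos (∑ i, η i * ((x i : ℝ) / √(N * Real.log N))) := by
  have hl := Real.log_pos hN
  have hA : 0 < N * Real.log N := by positivity
  have hs : 0 < √(N * Real.log N) := Real.sqrt_pos.2 hA
  have hpow : (N * Real.log N) ^ ((d : ℝ) / 2) = √(N * Real.log N) ^ d := by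
    rw [Real.sqrt_eq_rpow, ← Real.rpow_natCast, ← Real.rpow_mul hA.le]
    congr 1
    ring
  have h := Measure.integral_comp_inv_smul (volume : Measure (Fin d → ℝ))
    ((Set.univ.pi fun _ : Fin d => Set.Icc (-Real.pi) Real.pi).indicator fun θ =>
      Real.exp (t * N * latticeSymbol d 2 θ) * Real.cos (∑ i, (x i : ℝ) * θ i))
    (√(N * Real.log N))
  rw [integral_indicator (MeasurableSet.univ_pi fun _ => measurableSet_Icc),
    Module.finrank_fin_fun, abs_of_pos (by positivity), smul_eq_mul] at h
  rw [pTrans, hpow, mul_left_comm, ← h]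
  congr 2
  ext η
  simp only [scaledChar, Set.indicator]
  split_ifs
  · congr 2
    · rw [latticeSymbol_two]; ring
    · refine Finset.sum_congr rfl fun i _ => ?_
      simp only [Pi.smul_apply, smul_eq_mul]
      ring
  · simp

lemma fDensityTwo_eq (d : ℕ) [NeZero d] (t : ℝ) (u : Fin d → ℝ) :
    fDensityTwo d t u = ((2 * Real.pi) ^ d)⁻¹ * ∫ η : Fin d → ℝ,
      Real.exp (-(t * (unitBallVol d / 4 * l2norm η ^ 2))) * Real.cos (∑ i, η i * u i) := by
  rw [fDensityTwo]
  congr 2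
  ext η
  rw [sum_Kconst, l2norm_sq, mul_comm]
  congr 2
  ring

/-- **Local central limit theorem, case `α = 2`** (Lemma LCLT):
`lim_{N→∞} sup_{x ∈ Z^d} |(N log N)^{d/2} p_{tN}^{d,2}(0,x) − f_t^{d,2}(x/√(N log N))| = 0`,
the limit being over real `N > 1`. -/
theorem lclt_alpha_eq_two (d : ℕ) (hd : 1 ≤ d) (t : ℝ) (ht : 0 < t) :
    ∀ ε > 0, ∃ N₀ : ℝ, ∀ N : ℝ, 1 < N → N₀ ≤ N → ∀ x : Fin d → ℤ,
      |(N * Real.log N) ^ ((d : ℝ) / 2) * pTrans d 2 (t * N) x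
        - fDensityTwo d t (fun i => (x i : ℝ) / Real.sqrt (N * Real.log N))| < ε := by
  intro ε hε
  have : NeZero d := ⟨by omega⟩
  have hlim := (tendsto_integral_abs_scaledChar_sub d ht).const_mul ((2 * Real.pi) ^ d)⁻¹
  rw [mul_zero] at hlim
  obtain ⟨N₀, hN₀⟩ := eventually_atTop.1
    ((hlim.eventually_lt_const hε).and (eventually_integrable_scaledChar d ht))
  refine ⟨N₀, fun N hN1 hN x => ?_⟩
  obtain ⟨hlt, hint⟩ := hN₀ N hN
  have hgauss := integrable_gaussian_l2norm d ht
  set c : (Fin d → ℝ) → ℝ := fun η => Real.cos (∑ i, η i * ((x i : ℝ) / √(N * Real.log N))) with hc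
  have hcm : AEStronglyMeasurable c :=
    (by fun_prop : Continuous c).aestronglyMeasurable
  have hc1 : ∀ᵐ η, ‖c η‖ ≤ 1 := ae_of_all _ fun η => Real.abs_cos_le_one _
  rw [pTrans_two_eq d hN1, fDensityTwo_eq, ← mul_sub,
    ← integral_sub (hint.mul_bdd hcm hc1) (hgauss.mul_bdd hcm hc1), abs_mul,
    abs_of_pos (by positivity)]
  refine lt_of_le_of_lt ?_ hlt
  gcongr
  refine (abs_integral_le_integral_abs).trans ?_
  refine integral_mono_of_nonneg (ae_of_all _ fun η => abs_nonneg _) (hint.sub hgauss).abs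
    (ae_of_all _ fun η => ?_)
  simp only [← sub_mul, abs_mul]
  exact mul_le_of_le_one_right (abs_nonneg _) (Real.abs_cos_le_one _)
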